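/- Let h : X → Y be a continuous homomorphism from a k-complete Hausdorff topological semilattice X to a Hausdorff topological semilattice Y. Then h(X) is closed in Y. -/

import Mathlib

/-- `X` is k-complete if every non-empty chain has an inf and a sup, both in
the closure of the chain. -/
def KComplete (X : Type*) [TopologicalSpace X] [SemilatticeInf X] : Prop :=
  ∀ C : Set X, IsChain (· ≤ ·) C → C.Nonempty →
    (∃ a : X, IsGLB C a ∧ a ∈ closure C) ∧ (∃ b : X, IsLUB C b ∧ b ∈ closure C)

/-- closed subsemilattice -/
def CSub {X : Type*} [TopologicalSpace X] [SemilatticeInf X] (A : Set X) : Prop :=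
  IsClosed A ∧ ∀ a ∈ A, ∀ b ∈ A, a ⊓ b ∈ A

theorem CSub.inter {X : Type*} [TopologicalSpace X] [SemilatticeInf X] {A B : Set X}
    (hA : CSub A) (hB : CSub B) : CSub (A ∩ B) :=
  ⟨hA.1.inter hB.1, fun a ha b hb => ⟨hA.2 a ha.1 b hb.1, hB.2 a ha.2 b hb.2⟩⟩

theorem CSub.exists_least {X : Type*} [TopologicalSpace X] [SemilatticeInf X]
    (hk : KComplete X) {A : Set X} (hA : CSub A) (hne : A.Nonempty) :
    ∃ m ∈ A, ∀ a ∈ A, m ≤ a := by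
  obtain ⟨x, hx⟩ := hne
  obtain ⟨m, hmx, hm⟩ := zorn_le_nonempty₀ (α := Xᵒᵈ) (OrderDual.ofDual ⁻¹' A) (by
    intro c hc hch y hy
    obtain ⟨⟨a, ha, hac⟩, -⟩ := hk (OrderDual.toDual ⁻¹' c) (by
      intro u hu v hv huv
      exact (hch hu hv huv).symm) ⟨_, hy⟩
    exact ⟨OrderDual.toDual a, closure_minimal (fun u hu => hc hu) hA.1 hac,
      fun z hz => ha.1 hz⟩) (OrderDual.toDual x) hx
  refine ⟨OrderDual.ofDual m, hm.1, fun a ha => ?_⟩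
  have h1 := hm.2 (y := OrderDual.toDual (OrderDual.ofDual m ⊓ a)) (hA.2 _ hm.1 _ ha)
    (inf_le_left : OrderDual.ofDual m ⊓ a ≤ OrderDual.ofDual m)
  exact le_trans (show OrderDual.ofDual m ≤ OrderDual.ofDual m ⊓ a from h1) inf_le_right

theorem CSub.chain {X : Type*} [TopologicalSpace X] [SemilatticeInf X]
    (hk : KComplete X) {ι : Type*} [Nonempty ι] (A : ι → Set X) (hA : ∀ i, CSub (A i))
    (hne : ∀ i, (A i).Nonempty) (hch : ∀ i j, A i ⊆ A j ∨ A j ⊆ A i) :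
    (⋂ i, A i).Nonempty := by
  choose m hm hle using fun i => (hA i).exists_least hk (hne i)
  have key : ∀ S : Set ι, IsChain (· ≤ ·) (m '' S) := by
    rintro S _ ⟨i, -, rfl⟩ _ ⟨j, -, rfl⟩ -
    rcases hch i j with h | h
    · exact Or.inr (hle j _ (h (hm i)))
    · exact Or.inl (hle i _ (h (hm j)))
  obtain ⟨-, s, hs, -⟩ := hk (m '' Set.univ) (key _) (Set.univ_nonempty.image _)
  refine ⟨s, Set.mem_iInter.2 fun j => ?_⟩
  obtain ⟨-, b, hb, hbc⟩ := hk (m '' {i | A i ⊆ A j}) (key _) ⟨_, j, Set.Subset.refl (A j), rfl⟩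
  have hbs : s = b := by
    apply le_antisymm
    · apply hs.2
      rintro _ ⟨i, -, rfl⟩
      rcases hch i j with h | h
      · exact hb.1 ⟨i, h, rfl⟩
      · exact (hle i _ (h (hm j))).trans (hb.1 ⟨j, Set.Subset.refl (A j), rfl⟩)
    · apply hb.2
      rintro _ ⟨i, -, rfl⟩
      exact hs.1 ⟨i, trivial, rfl⟩
  rw [hbs]
  refine closure_minimal ?_ (hA j).1 hbc
  rintro _ ⟨i, hi, rfl⟩
  exact hi (hm i)

theorem CSub.directed {X : Type*} [TopologicalSpace X] [SemilatticeInf X]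
    (hk : KComplete X) (F : Set (Set X)) (hF : ∀ A ∈ F, CSub A)
    (hne : ∀ A ∈ F, A.Nonempty) (hF0 : F.Nonempty)
    (hd : ∀ A ∈ F, ∀ B ∈ F, ∃ C ∈ F, C ⊆ A ∩ B) : ∃ x, ∀ A ∈ F, x ∈ A := by
  obtain ⟨M, -, hM⟩ := zorn_superset_nonempty
    {A : Set X | CSub A ∧ ∀ B ∈ F, (A ∩ B).Nonempty} (by
      intro c hc hch hcne
      have : Nonempty c := hcne.to_subtype
      refine ⟨⋂₀ c, ⟨⟨isClosed_sInter fun t ht => (hc ht).1.1, fun a ha b hb t ht =>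
        (hc ht).1.2 a (ha t ht) b (hb t ht)⟩, fun B hB => ?_⟩,
        fun s hs => Set.sInter_subset_of_mem hs⟩
      obtain ⟨x, hx⟩ := CSub.chain hk (fun i : c => (i : Set X) ∩ B)
        (fun i => (hc i.2).1.inter (hF B hB)) (fun i => (hc i.2).2 B hB) (fun i j => by
          rcases hch.total i.2 j.2 with h | h
          · exact Or.inl (Set.inter_subset_inter_left _ h)
          · exact Or.inr (Set.inter_subset_inter_left _ h))
      rw [Set.mem_iInter] at hx
      exact ⟨x, fun t ht => (hx ⟨t, ht⟩).1, (hx (Classical.arbitrary c)).2⟩)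
    Set.univ ⟨⟨isClosed_univ, fun _ _ _ _ => trivial⟩, fun B hB => by
      simpa using hne B hB⟩
  obtain ⟨B, hB⟩ := hF0
  obtain ⟨x, hx, -⟩ := hM.1.2 B hB
  refine ⟨x, fun A hA => ?_⟩
  have := hM.2 (y := M ∩ A) ⟨hM.1.1.inter (hF A hA), fun B hB => by
    obtain ⟨C, hC, hCs⟩ := hd A hA B hB
    obtain ⟨z, hz, hzC⟩ := hM.1.2 C hC
    exact ⟨z, ⟨hz, (hCs hzC).1⟩, (hCs hzC).2⟩⟩ Set.inter_subset_left
  exact (this hx).2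

/-- iterated meets -/
def pmeet {X : Type*} [SemilatticeInf X] (x : ℕ → X) : ℕ → ℕ → X
  | 0, n => x n
  | m + 1, n => x n ⊓ pmeet x m (n + 1)

theorem seq_nonempty {X : Type*} [TopologicalSpace X] [SemilatticeInf X]
    (hk : KComplete X) (V : ℕ → Set X) (hV : ∀ n, ∀ a ∈ V (n + 1), ∀ b ∈ V (n + 1), a ⊓ b ∈ V n)
    (hne : ∀ n, (V n).Nonempty) : (⋂ n, closure (V n)).Nonempty := by
  have hsub : ∀ n, V (n + 1) ⊆ V n := fun n a ha => by simpa using hV n a ha a ha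
  have hanti : Antitone V := antitone_nat_of_succ_le hsub
  choose x hx using fun n => hne (n + 1)
  have hp : ∀ m n, pmeet x m n ∈ V n := by
    intro m
    induction m with
    | zero => exact fun n => hsub n (hx n)
    | succ m ih => exact fun n => hV n _ (hx n) _ (ih (n + 1))
  have hdec : ∀ m n, pmeet x (m + 1) n ≤ pmeet x m n := by
    intro m
    induction m with
    | zero => exact fun n => inf_le_left
    | succ m ih => exact fun n => inf_le_inf_left _ (ih (n + 1))
  have hz : ∀ n, ∃ z, IsGLB (Set.range fun m => pmeet x m n) z ∧ z ∈ closure (V n) := by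
    intro n
    have ha : Antitone fun m => pmeet x m n := antitone_nat_of_succ_le fun m => hdec m n
    obtain ⟨⟨z, hz, hzc⟩, -⟩ := hk (Set.range fun m => pmeet x m n) (by
      rintro _ ⟨i, rfl⟩ _ ⟨j, rfl⟩ -
      rcases le_total i j with h | h
      · exact Or.inr (ha h)
      · exact Or.inl (ha h)) (Set.range_nonempty _)
    refine ⟨z, hz, closure_mono ?_ hzc⟩
    rintro _ ⟨m, rfl⟩
    exact hp m n
  choose z hz hzc using hz
  have hmono : Monotone z := monotone_nat_of_le_succ fun n => by
    apply (hz (n + 1)).2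
    rintro _ ⟨m, rfl⟩
    exact ((hz n).1 ⟨m + 1, rfl⟩).trans inf_le_right
  have key : ∀ S : Set ℕ, IsChain (· ≤ ·) (z '' S) := by
    rintro S _ ⟨i, -, rfl⟩ _ ⟨j, -, rfl⟩ -
    rcases le_total i j with h | h
    · exact Or.inl (hmono h)
    · exact Or.inr (hmono h)
  obtain ⟨-, s, hs, -⟩ := hk (z '' Set.univ) (key _) (Set.univ_nonempty.image _)
  refine ⟨s, Set.mem_iInter.2 fun n => ?_⟩
  obtain ⟨-, b, hb, hbc⟩ := hk (z '' Set.Ici n) (key _) ⟨_, n, Set.self_mem_Ici, rfl⟩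
  have hbs : s = b := by
    apply le_antisymm
    · apply hs.2
      rintro _ ⟨i, -, rfl⟩
      exact (hmono (le_max_left i n)).trans (hb.1 ⟨max i n, le_max_right i n, rfl⟩)
    · apply hb.2
      rintro _ ⟨i, -, rfl⟩
      exact hs.1 ⟨i, trivial, rfl⟩
  rw [hbs]
  refine closure_minimal ?_ isClosed_closure hbc
  rintro _ ⟨i, hi, rfl⟩
  exact closure_mono (hanti hi) (hzc i)

/-- A continuous homomorphism from a k-complete Hausdorff topological
semilattice to a Hausdorff topological semilattice has closed image. -/
theorem image_closed_of_kComplete {X Y : Type*}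
    [TopologicalSpace X] [T2Space X] [SemilatticeInf X]
    [TopologicalSpace Y] [T2Space Y] [SemilatticeInf Y]
    (hcontX : Continuous fun p : X × X => p.1 ⊓ p.2)
    (hcontY : Continuous fun p : Y × Y => p.1 ⊓ p.2)
    (hk : KComplete X)
    (h : X → Y) (hc : Continuous h) (hhom : ∀ a b : X, h (a ⊓ b) = h a ⊓ h b) :
    IsClosed (Set.range h) := by
  rw [← closure_subset_iff_isClosed]
  intro y hy
  let Q : (ℕ → Set Y) → Prop := fun U => (∀ n, U n ∈ nhds y) ∧
    ∀ n, ∀ a ∈ U (n + 1), ∀ b ∈ U (n + 1), a ⊓ b ∈ U n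
  have hstep : ∀ V : {V : Set Y // V ∈ nhds y}, ∃ W : {V : Set Y // V ∈ nhds y},
      ∀ a ∈ W.1, ∀ b ∈ W.1, a ⊓ b ∈ V.1 := by
    rintro ⟨V, hV⟩
    have h1 : (fun p : Y × Y => p.1 ⊓ p.2) ⁻¹' V ∈ nhds (y, y) :=
      hcontY.continuousAt (by simpa using hV)
    rw [nhds_prod_eq, Filter.mem_prod_same_iff] at h1
    obtain ⟨W, hW, hWV⟩ := h1
    exact ⟨⟨W, hW⟩, fun a ha b hb => hWV (Set.mk_mem_prod ha hb)⟩
  choose g hg using hstep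
  have hQ : ∀ V ∈ nhds y, ∃ U, Q U ∧ U 0 = V := fun V hV =>
    ⟨fun n => (g^[n] ⟨V, hV⟩).1, ⟨fun n => (g^[n] ⟨V, hV⟩).2, fun n => by
      simp only [Function.iterate_succ_apply']
      exact hg _⟩, rfl⟩
  obtain ⟨x, hx⟩ := CSub.directed hk {A | ∃ U, Q U ∧ A = ⋂ n, h ⁻¹' closure (U n)} (by
      rintro _ ⟨U, hU, rfl⟩
      refine ⟨isClosed_iInter fun n => isClosed_closure.preimage hc, fun a ha b hb => ?_⟩
      rw [Set.mem_iInter] at *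
      intro n
      rw [Set.mem_preimage, hhom]
      exact map_mem_closure₂ hcontY (ha (n + 1)) (hb (n + 1)) (hU.2 n)) (by
      rintro _ ⟨U, hU, rfl⟩
      refine (seq_nonempty hk (fun n => h ⁻¹' U n) (fun n a ha b hb => ?_) fun n => ?_).mono ?_
      · rw [Set.mem_preimage, hhom]
        exact hU.2 n _ ha _ hb
      · obtain ⟨_, hz, x, rfl⟩ := mem_closure_iff_nhds.1 hy _ (hU.1 n)
        exact ⟨x, hz⟩
      · exact Set.iInter_mono fun n => hc.closure_preimage_subset _) (by
      obtain ⟨U, hU, -⟩ := hQ _ Filter.univ_mem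
      exact ⟨_, U, hU, rfl⟩) (by
      rintro _ ⟨U, hU, rfl⟩ _ ⟨V, hV, rfl⟩
      refine ⟨_, ⟨fun n => U n ∩ V n, ⟨fun n => Filter.inter_mem (hU.1 n) (hV.1 n),
        fun n a ha b hb => ⟨hU.2 n a ha.1 b hb.1, hV.2 n a ha.2 b hb.2⟩⟩, rfl⟩, ?_⟩
      exact Set.subset_inter
        (Set.iInter_mono fun n => Set.preimage_mono (closure_mono Set.inter_subset_left))
        (Set.iInter_mono fun n => Set.preimage_mono (closure_mono Set.inter_subset_right)))
  refine ⟨x, ?_⟩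
  by_contra hne
  obtain ⟨u, v, hu, hv, hxu, hyv, huv⟩ := t2_separation hne
  obtain ⟨U, hU, hU0⟩ := hQ v (hv.mem_nhds hyv)
  have h1 := Set.mem_iInter.1 (hx _ ⟨U, hU, rfl⟩) 0
  rw [Set.mem_preimage, hU0] at h1
  obtain ⟨z, hzu, hzv⟩ := mem_closure_iff.1 h1 u hu hxu
  exact Set.disjoint_left.1 huv hzu hzv
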